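/- (Discrete dynamic programming principle, recursion.) Let A ⊂ ℝ^{d×d} be a nonempty compact set and let g : (0,∞)^d → ℝ be continuous, nonnegative and of polynomial growth. Then for every 0 ≤ n ≤ N−1 and every x ∈ (0,∞)^d, the value function satisfies V_n(x) = max_{a ∈ A} ∫_{ℝ^d} e^{−rT/N} V_{n+1}(F(x, a, z)) dγ_d(z), where the maximum over the compact set A is attained. -/

import Mathlib

open MeasureTheory ProbabilityTheory Matrix

/-- The Borel measurable-space structure on matrices (the product σ-algebra). -/
instance matrixMeasurableSpace (d : ℕ) : MeasurableSpace (Matrix (Fin d) (Fin d) ℝ) :=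
  (inferInstance : MeasurableSpace (Fin d → Fin d → ℝ))

/-- The log-Euler scheme map `F(x, a, ξ)^i = x^i exp((r - (aaᵀ)^{ii}/2) T/N + √(T/N) (aξ)^i)`. -/
noncomputable def logEuler (d : ℕ) (T r : ℝ) (N : ℕ)
    (x : Fin d → ℝ) (a : Matrix (Fin d) (Fin d) ℝ) (ξ : Fin d → ℝ) : Fin d → ℝ :=
  fun i => x i * Real.exp ((r - (1 / 2) * (a * aᵀ) i i) * (T / N)
    + Real.sqrt (T / N) * a.mulVec ξ i)

/-- The standard Gaussian measure `N(0, I_d)` on `ℝ^d`. -/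
noncomputable def stdGaussian (d : ℕ) : Measure (Fin d → ℝ) :=
  Measure.pi fun _ => gaussianReal 0 1

/-- A stochastic Markov policy with values in the admissible set `A`: a sequence of Borel
Markov kernels from the state space to the action space, each placing full mass on `A`. -/
def IsPolicy {d : ℕ} (A : Set (Matrix (Fin d) (Fin d) ℝ))
    (π : ℕ → Kernel (Fin d → ℝ) (Matrix (Fin d) (Fin d) ℝ)) : Prop :=
  ∀ k, IsMarkovKernel (π k) ∧ ∀ x : Fin d → ℝ, (π k) x A = 1

/-- The expected terminal payoff `E^π[g(X_N) | X_{N-m} = x]` of the controlled log-Euler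
chain under the stochastic Markov policy `π`, written (via Ionescu–Tulcea/Fubini) as an
iterated integral over actions and Gaussian innovations; `m` is the number of remaining
steps, so time is `n = N - m`. -/
noncomputable def polPay (d : ℕ) (T r : ℝ) (N : ℕ) (g : (Fin d → ℝ) → ℝ)
    (π : ℕ → Kernel (Fin d → ℝ) (Matrix (Fin d) (Fin d) ℝ)) :
    ℕ → (Fin d → ℝ) → ℝ
  | 0 => g
  | m + 1 => fun x =>
      ∫ a, ∫ z, polPay d T r N g π m (logEuler d T r N x a z)
        ∂(stdGaussian d) ∂((π (N - (m + 1))) x)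

/-- The value function `V_n(x) = sup_π E^π[e^{-r(T - nT/N)} g(X_N) | X_n = x]`, the
supremum over all stochastic Markov policies valued in `A` of the discounted expected
terminal payoff. -/
noncomputable def valueFn (d : ℕ) (T r : ℝ) (N : ℕ) (g : (Fin d → ℝ) → ℝ)
    (A : Set (Matrix (Fin d) (Fin d) ℝ)) (n : ℕ) (x : Fin d → ℝ) : ℝ :=
  sSup {v : ℝ | ∃ π : ℕ → Kernel (Fin d → ℝ) (Matrix (Fin d) (Fin d) ℝ),
    IsPolicy A π ∧
    v = Real.exp (-(r * (T - (n : ℝ) * T / N))) * polPay d T r N g π (N - n) x}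

open Set Filter Topology

/-- The positive orthant. -/
def posO (d : ℕ) : Set (Fin d → ℝ) := {x | ∀ i, 0 < x i}

instance matFC (d : ℕ) : SecondCountableTopology (Matrix (Fin d) (Fin d) ℝ) :=
  (inferInstance : SecondCountableTopology (Fin d → Fin d → ℝ))

instance matBorel (d : ℕ) : BorelSpace (Matrix (Fin d) (Fin d) ℝ) :=
  (inferInstance : BorelSpace (Fin d → Fin d → ℝ))

instance matT2 (d : ℕ) : T2Space (Matrix (Fin d) (Fin d) ℝ) :=
  (inferInstance : T2Space (Fin d → Fin d → ℝ))

instance stdG_prob (d : ℕ) : IsProbabilityMeasure (stdGaussian d) := by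
  unfold _root_.stdGaussian; infer_instance

lemma isOpen_posO (d : ℕ) : IsOpen (posO d) := by
  have : posO d = ⋂ i, {x : Fin d → ℝ | 0 < x i} := by ext x; simp [posO]
  rw [this]
  exact isOpen_iInter_of_finite fun i => isOpen_lt continuous_const (continuous_apply i)

lemma logEuler_pos {d : ℕ} {T r : ℝ} {N : ℕ} {x : Fin d → ℝ} (hx : x ∈ posO d) (a ξ) :
    logEuler d T r N x a ξ ∈ posO d := fun i => mul_pos (hx i) (Real.exp_pos _)

lemma logEuler_cont (d : ℕ) (T r : ℝ) (N : ℕ) :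
    Continuous fun q : (Fin d → ℝ) × Matrix (Fin d) (Fin d) ℝ × (Fin d → ℝ) =>
      logEuler d T r N q.1 q.2.1 q.2.2 := by
  unfold logEuler
  refine continuous_pi fun i => ?_
  have h1 : Continuous fun q : (Fin d → ℝ) × Matrix (Fin d) (Fin d) ℝ × (Fin d → ℝ) =>
      (q.2.1 * q.2.1ᵀ) i i :=
    (Continuous.matrix_mul (by fun_prop) (by fun_prop)).matrix_elem i i
  have h2 : Continuous fun q : (Fin d → ℝ) × Matrix (Fin d) (Fin d) ℝ × (Fin d → ℝ) =>
      q.2.1.mulVec q.2.2 i :=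
    (continuous_apply i).comp (Continuous.matrix_mulVec (by fun_prop) (by fun_prop))
  fun_prop

lemma compact_bd {d : ℕ} {A : Set (Matrix (Fin d) (Fin d) ℝ)} (hA : IsCompact A) :
    ∃ M : ℝ, 0 ≤ M ∧ ∀ a ∈ A, ∀ i j, |a i j| ≤ M := by
  have hc : Continuous fun a : Matrix (Fin d) (Fin d) ℝ => ∑ i, ∑ j, |a i j| := by
    refine continuous_finsetSum _ fun i _ => continuous_finsetSum _ fun j _ => ?_
    exact (continuous_id.matrix_elem i j).abs
  obtain ⟨M, hM⟩ := hA.bddAbove_image hc.continuousOn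
  refine ⟨max M 0, le_max_right _ _, fun a ha i j => ?_⟩
  have h1 : ∑ i, ∑ j, |a i j| ≤ M := hM ⟨a, ha, rfl⟩
  have h2 : |a i j| ≤ ∑ j, |a i j| :=
    Finset.single_le_sum (f := fun j => |a i j|) (fun _ _ => abs_nonneg _) (Finset.mem_univ j)
  have h3 : ∑ j, |a i j| ≤ ∑ i, ∑ j, |a i j| :=
    Finset.single_le_sum (f := fun i => ∑ j, |a i j|)
      (fun _ _ => Finset.sum_nonneg fun _ _ => abs_nonneg _) (Finset.mem_univ i)
  exact (h2.trans (h3.trans h1)).trans (le_max_left _ _)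

lemma integrable_expsum (d : ℕ) (K : ℝ) :
    Integrable (fun z : Fin d → ℝ => Real.exp (K * ∑ j, |z j|)) (stdGaussian d) := by
  have h1 : Integrable (fun t : ℝ => Real.exp (K * |t|)) (gaussianReal 0 1) := by
    have := (integrable_exp_mul_gaussianReal (μ := 0) (v := 1) K).add
      (integrable_exp_mul_gaussianReal (μ := 0) (v := 1) (-K))
    refine this.mono' (by fun_prop) (ae_of_all _ fun t => ?_)
    rw [Real.norm_eq_abs, abs_of_pos (Real.exp_pos _)]
    simp only [Pi.add_apply]
    rcases abs_cases t with ⟨h, _⟩ | ⟨h, _⟩ <;> rw [h]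
    · exact le_add_of_nonneg_right (Real.exp_pos _).le
    · rw [mul_neg, ← neg_mul]; exact le_add_of_nonneg_left (Real.exp_pos _).le
  have h2 := Integrable.fintype_prod (μ := fun _ : Fin d => gaussianReal 0 1)
    (f := fun _ : Fin d => fun t : ℝ => Real.exp (K * |t|)) (fun _ => h1)
  refine h2.congr (ae_of_all _ fun z => ?_)
  simp only [Finset.mul_sum, Real.exp_sum]

/-- The dominating exponential factor. -/
noncomputable def domE (d : ℕ) (T r : ℝ) (N : ℕ) (M p : ℝ) (z : Fin d → ℝ) : ℝ :=
  Real.exp (p * (r * (T / N))) * Real.exp ((p * (Real.sqrt (T / N) * M)) * ∑ j, |z j|)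

lemma domE_int (d : ℕ) (T r : ℝ) (N : ℕ) (M p : ℝ) :
    Integrable (domE d T r N M p) (stdGaussian d) := (integrable_expsum d _).const_mul _

lemma domE_nonneg (d : ℕ) (T r : ℝ) (N : ℕ) (M p : ℝ) (z) : 0 ≤ domE d T r N M p z := by
  unfold domE; positivity

lemma logEuler_norm {d : ℕ} {T r : ℝ} (hT : 0 < T) {N : ℕ} {M p : ℝ} (hp : 0 ≤ p)
    {x : Fin d → ℝ} (hx : x ∈ posO d) {a : Matrix (Fin d) (Fin d) ℝ}
    (ha : ∀ i j, |a i j| ≤ M) (z : Fin d → ℝ) :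
    ‖logEuler d T r N x a z‖ ^ p ≤ ‖x‖ ^ p * domE d T r N M p z := by
  have hTN : 0 ≤ T / N := by positivity
  set E := r * (T / N) + Real.sqrt (T / N) * M * ∑ j, |z j| with hE
  have key : ‖logEuler d T r N x a z‖ ≤ ‖x‖ * Real.exp E := by
    refine (pi_norm_le_iff_of_nonneg (by positivity)).2 fun i => ?_
    rw [Real.norm_eq_abs, abs_of_pos (logEuler_pos hx a z i)]
    unfold logEuler
    have hxi : x i ≤ ‖x‖ := (le_abs_self _).trans (norm_le_pi_norm x i)
    refine mul_le_mul hxi (Real.exp_le_exp.2 ?_) (Real.exp_pos _).le (norm_nonneg _)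
    have h1 : 0 ≤ (a * aᵀ) i i := by
      rw [Matrix.mul_apply]
      exact Finset.sum_nonneg fun j _ => by
        rw [Matrix.transpose_apply]; exact mul_self_nonneg _
    have h2 : a.mulVec z i ≤ M * ∑ j, |z j| := by
      have e : a.mulVec z i = ∑ j, a i j * z j := rfl
      rw [e, Finset.mul_sum]
      refine Finset.sum_le_sum fun j _ => ?_
      calc a i j * z j ≤ |a i j * z j| := le_abs_self _
        _ = |a i j| * |z j| := abs_mul _ _
        _ ≤ M * |z j| := mul_le_mul_of_nonneg_right (ha i j) (abs_nonneg _)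
    have h3 := mul_le_mul_of_nonneg_left h2 (Real.sqrt_nonneg (T / N))
    have h4 : (r - (1 / 2) * (a * aᵀ) i i) * (T / N) ≤ r * (T / N) :=
      mul_le_mul_of_nonneg_right (by linarith) hTN
    rw [hE, mul_assoc]
    exact add_le_add h4 h3
  calc ‖logEuler d T r N x a z‖ ^ p ≤ (‖x‖ * Real.exp E) ^ p :=
        Real.rpow_le_rpow (norm_nonneg _) key hp
    _ = ‖x‖ ^ p * Real.exp E ^ p := Real.mul_rpow (norm_nonneg _) (Real.exp_pos _).le
    _ = ‖x‖ ^ p * domE d T r N M p z := by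
        rw [← Real.exp_mul, domE, ← Real.exp_add, hE]
        congr 2; ring

/-- Continuous, nonnegative, polynomial growth of exponent `p`. -/
def Good {d : ℕ} (p : ℝ) (h : (Fin d → ℝ) → ℝ) : Prop :=
  ContinuousOn h (posO d) ∧ (∀ y ∈ posO d, 0 ≤ h y) ∧
    ∃ C : ℝ, 0 ≤ C ∧ ∀ y ∈ posO d, h y ≤ C * (1 + ‖y‖ ^ p)

/-- One-step expectation. -/
noncomputable def stepE (d : ℕ) (T r : ℝ) (N : ℕ) (h : (Fin d → ℝ) → ℝ)
    (x : Fin d → ℝ) (a : Matrix (Fin d) (Fin d) ℝ) : ℝ :=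
  ∫ z, h (logEuler d T r N x a z) ∂(stdGaussian d)

section step
variable {d : ℕ} {T r : ℝ} {N : ℕ} {A : Set (Matrix (Fin d) (Fin d) ℝ)} {p : ℝ}
  {h : (Fin d → ℝ) → ℝ}

lemma step_cont_z (hh : ContinuousOn h (posO d)) {x} (hx : x ∈ posO d) (a) :
    Continuous fun z => h (logEuler d T r N x a z) :=
  hh.comp_continuous ((logEuler_cont d T r N).comp (by fun_prop : Continuous fun z => (x, a, z)))
    fun z => logEuler_pos hx a z

lemma step_bound (hT : 0 < T) (hp : 0 ≤ p) {C M : ℝ} (hC : 0 ≤ C)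
    (hh0 : ∀ y ∈ posO d, 0 ≤ h y)
    (hg : ∀ y ∈ posO d, h y ≤ C * (1 + ‖y‖ ^ p)) {x} (hx : x ∈ posO d) {a}
    (ha : ∀ i j, |a i j| ≤ M) (z) :
    ‖h (logEuler d T r N x a z)‖ ≤ C * (1 + ‖x‖ ^ p * domE d T r N M p z) := by
  rw [Real.norm_eq_abs, abs_of_nonneg (hh0 _ (logEuler_pos hx a z))]
  refine (hg _ (logEuler_pos hx a z)).trans (mul_le_mul_of_nonneg_left ?_ hC)
  exact add_le_add le_rfl (logEuler_norm hT hp hx ha z)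

lemma bound_int (C M c : ℝ) :
    Integrable (fun z => C * (1 + c * domE d T r N M p z)) (stdGaussian d) :=
  ((integrable_const _).add ((domE_int d T r N M p).const_mul c)).const_mul C

lemma step_int (hT : 0 < T) (hp : 0 ≤ p) (hA : IsCompact A) (hh : Good p h)
    {x} (hx : x ∈ posO d) {a} (ha : a ∈ A) :
    Integrable (fun z => h (logEuler d T r N x a z)) (stdGaussian d) := by
  obtain ⟨M, _, hM⟩ := compact_bd hA
  obtain ⟨h1, h2, C, hC, h3⟩ := hh
  exact (bound_int C M (‖x‖ ^ p)).mono' (step_cont_z h1 hx a).aestronglyMeasurable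
    (ae_of_all _ fun z => step_bound hT hp hC h2 h3 hx (hM a ha) z)

lemma step_nonneg (hh : Good p h) {x} (hx : x ∈ posO d) (a) : 0 ≤ stepE d T r N h x a :=
  integral_nonneg fun z => hh.2.1 _ (logEuler_pos hx a z)

lemma step_growth (hT : 0 < T) (hp : 0 ≤ p) (hA : IsCompact A) (hh : Good p h) :
    ∃ C : ℝ, 0 ≤ C ∧ ∀ x ∈ posO d, ∀ a ∈ A, stepE d T r N h x a ≤ C * (1 + ‖x‖ ^ p) := by
  obtain ⟨M, _, hM⟩ := compact_bd hA
  have hh' := hh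
  obtain ⟨h1, h2, C, hC, h3⟩ := hh
  set K := ∫ z, domE d T r N M p z ∂(stdGaussian d)
  have hK : 0 ≤ K := integral_nonneg (domE_nonneg d T r N M p)
  refine ⟨C * (1 + K), by positivity, fun x hx a ha => ?_⟩
  have e : ∫ z, C * (1 + ‖x‖ ^ p * domE d T r N M p z) ∂(stdGaussian d)
      = C * (1 + ‖x‖ ^ p * K) := by
    rw [integral_const_mul, integral_add (integrable_const _) ((domE_int d T r N M p).const_mul _),
      integral_const_mul]
    simp [K]
  have : stepE d T r N h x a ≤ C * (1 + ‖x‖ ^ p * K) := by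
    rw [← e]
    exact integral_mono (step_int hT hp hA hh' hx ha) (bound_int C M (‖x‖ ^ p))
      fun z => (le_abs_self _).trans (step_bound hT hp hC h2 h3 hx (hM a ha) z)
  refine this.trans ?_
  rw [mul_assoc]
  refine mul_le_mul_of_nonneg_left ?_ hC
  have : 0 ≤ ‖x‖ ^ p := by positivity
  nlinarith

lemma step_cont (hT : 0 < T) (hp : 0 ≤ p) (hA : IsCompact A) (hh : Good p h) :
    ContinuousOn (fun q : (Fin d → ℝ) × Matrix (Fin d) (Fin d) ℝ => stepE d T r N h q.1 q.2)
      (posO d ×ˢ A) := by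
  obtain ⟨M, _, hM⟩ := compact_bd hA
  obtain ⟨h1, h2, C, hC, h3⟩ := hh
  rintro ⟨x0, a0⟩ ⟨hx0, ha0⟩
  unfold stepE
  refine continuousWithinAt_of_dominated
    (bound := fun z => C * (1 + (‖x0‖ + 1) ^ p * domE d T r N M p z)) ?_ ?_
    (bound_int C M _) ?_
  · filter_upwards [self_mem_nhdsWithin] with q hq
    exact (step_cont_z h1 hq.1 q.2).aestronglyMeasurable
  · have hn : ∀ᶠ q : (Fin d → ℝ) × Matrix (Fin d) (Fin d) ℝ in 𝓝[posO d ×ˢ A] (x0, a0),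
        ‖q.1‖ < ‖x0‖ + 1 := by
      refine mem_nhdsWithin_of_mem_nhds ?_
      exact (isOpen_lt (continuous_fst.norm) continuous_const).mem_nhds (by simp)
    filter_upwards [self_mem_nhdsWithin, hn] with q hq hqn
    refine ae_of_all _ fun z => (step_bound hT hp hC h2 h3 hq.1 (hM _ hq.2) z).trans ?_
    refine mul_le_mul_of_nonneg_left (add_le_add le_rfl ?_) hC
    exact mul_le_mul_of_nonneg_right (Real.rpow_le_rpow (norm_nonneg _) hqn.le hp)
      (domE_nonneg d T r N M p z)
  · refine ae_of_all _ fun z => ?_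
    have hc : Continuous fun q : (Fin d → ℝ) × Matrix (Fin d) (Fin d) ℝ =>
        logEuler d T r N q.1 q.2 z :=
      (logEuler_cont d T r N).comp (by fun_prop :
        Continuous fun q : (Fin d → ℝ) × Matrix (Fin d) (Fin d) ℝ => (q.1, q.2, z))
    exact (h1.comp hc.continuousOn fun q hq => logEuler_pos hq.1 q.2 z) (x0, a0) ⟨hx0, ha0⟩

lemma step_cont_a (hT : 0 < T) (hp : 0 ≤ p) (hA : IsCompact A) (hh : Good p h)
    {x} (hx : x ∈ posO d) : ContinuousOn (stepE d T r N h x) A :=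
  (step_cont (r := r) (N := N) hT hp hA hh).comp (f := fun a => (x, a))
    (by fun_prop) fun _ ha => ⟨hx, ha⟩

/-- Bellman operator. -/
noncomputable def bell (d : ℕ) (T r : ℝ) (N : ℕ) (A : Set (Matrix (Fin d) (Fin d) ℝ))
    (h : (Fin d → ℝ) → ℝ) (x : Fin d → ℝ) : ℝ := sSup (stepE d T r N h x '' A)

lemma bell_greatest (hT : 0 < T) (hp : 0 ≤ p) (hA : IsCompact A) (hne : A.Nonempty)
    (hh : Good p h) {x} (hx : x ∈ posO d) :
    IsGreatest (stepE d T r N h x '' A) (bell d T r N A h x) :=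
  (hA.image_of_continuousOn (step_cont_a hT hp hA hh hx)).isGreatest_sSup (hne.image _)

lemma bell_good (hT : 0 < T) (hp : 0 ≤ p) (hA : IsCompact A) (hne : A.Nonempty)
    (hh : Good p h) : Good p (bell d T r N A h) := by
  refine ⟨?_, ?_, ?_⟩
  · rw [continuousOn_iff_continuous_domRestrict]
    have : CompactSpace A := isCompact_iff_compactSpace.1 hA
    have hc : Continuous (fun q : posO d × A => stepE d T r N h q.1 q.2) :=
      (step_cont (r := r) (N := N) hT hp hA hh).comp_continuous
        (f := fun q : posO d × A => ((q.1 : Fin d → ℝ), (q.2 : Matrix (Fin d) (Fin d) ℝ)))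
        (by fun_prop) fun q => ⟨q.1.2, q.2.2⟩
    have := IsCompact.continuous_sSup (f := fun (x : posO d) (a : A) => stepE d T r N h x a)
      (K := univ) isCompact_univ hc
    convert this using 2 with x
    simp only [Set.domRestrict_apply, bell]
    congr 1
    ext v; simp
  · intro x hx
    obtain ⟨a, _, e⟩ := (bell_greatest (r := r) (N := N) hT hp hA hne hh hx).1
    rw [← e]; exact step_nonneg hh hx a
  · obtain ⟨C, hC, hb⟩ := step_growth (r := r) (N := N) hT hp hA hh
    refine ⟨C, hC, fun x hx => ?_⟩
    obtain ⟨a, ha, e⟩ := (bell_greatest (r := r) (N := N) hT hp hA hne hh hx).1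
    rw [← e]; exact hb x hx a ha

lemma exists_selector (hT : 0 < T) (hp : 0 ≤ p) (hA : IsCompact A) (hne : A.Nonempty)
    (hh : Good p h) {ε : ℝ} (hε : 0 < ε) :
    ∃ s : (Fin d → ℝ) → Matrix (Fin d) (Fin d) ℝ, Measurable s ∧ (∀ x, s x ∈ A) ∧
      ∀ x ∈ posO d, bell d T r N A h x - ε < stepE d T r N h x (s x) := by
  classical
  have : Nonempty A := hne.to_subtype
  let u : ℕ → A := TopologicalSpace.denseSeq A
  let P : (Fin d → ℝ) → ℕ → Prop := fun x k =>
    x ∉ posO d ∨ (x ∈ posO d ∧ bell d T r N A h x - ε < stepE d T r N h x (u k))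
  have hP : ∀ x, ∃ k, P x k := by
    intro x
    by_cases hx : x ∈ posO d
    · obtain ⟨a, ha, e⟩ := (bell_greatest (r := r) (N := N) hT hp hA hne hh hx).1
      have hc : Continuous fun b : A => stepE d T r N h x b :=
        continuousOn_iff_continuous_domRestrict.1 (step_cont_a (r := r) (N := N) hT hp hA hh hx)
      have ho : IsOpen {b : A | bell d T r N A h x - ε < stepE d T r N h x b} :=
        isOpen_lt continuous_const hc
      obtain ⟨b, hb, k, rfl⟩ := (TopologicalSpace.denseRange_denseSeq A).inter_open_nonempty _ ho
        ⟨⟨a, ha⟩, by simp only [mem_ofPred_eq]; rw [e]; linarith⟩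
      exact ⟨k, Or.inr ⟨hx, hb⟩⟩
    · exact ⟨0, Or.inl hx⟩
  have hm : ∀ k, MeasurableSet {x | P x k} := by
    intro k
    have hc : ContinuousOn (fun x => stepE d T r N h x (u k) - bell d T r N A h x) (posO d) := by
      have hc1 : ContinuousOn (fun x => stepE d T r N h x (u k)) (posO d) :=
        (step_cont (r := r) (N := N) hT hp hA hh).comp
          (f := fun x : Fin d → ℝ => (x, (u k : Matrix (Fin d) (Fin d) ℝ)))
          (Continuous.prodMk continuous_id continuous_const).continuousOn
          fun _ hx => ⟨hx, (u k).2⟩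
      exact hc1.sub (bell_good hT hp hA hne hh).1
    have := (hc.isOpen_inter_preimage (isOpen_posO d) (isOpen_Ioi (a := -ε))).measurableSet
    have e : {x | P x k} = (posO d)ᶜ ∪ (posO d ∩
        (fun x => stepE d T r N h x (u k) - bell d T r N A h x) ⁻¹' Ioi (-ε)) := by
      ext x
      simp only [P, mem_ofPred_eq, mem_union, mem_compl_iff, mem_inter_iff, mem_preimage, mem_Ioi]
      refine or_congr_right (and_congr_right fun _ =>
        ⟨fun h => by linarith, fun h => by linarith⟩)
    rw [e]
    exact (isOpen_posO d).measurableSet.compl.union this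
  refine ⟨fun x => u (Nat.find (hP x)), ?_, fun x => (u _).2, fun x hx => ?_⟩
  · exact (measurable_from_nat (f := fun k => (u k : Matrix (Fin d) (Fin d) ℝ))).comp (measurable_find hP hm)
  · rcases Nat.find_spec (hP x) with h | h
    · exact absurd hx h
    · exact h.2

end step

/-- Iterated Bellman operator. -/
noncomputable def bellW (d : ℕ) (T r : ℝ) (N : ℕ) (A : Set (Matrix (Fin d) (Fin d) ℝ))
    (g : (Fin d → ℝ) → ℝ) : ℕ → (Fin d → ℝ) → ℝ
  | 0 => g
  | m + 1 => bell d T r N A (bellW d T r N A g m)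

section main
variable {d : ℕ} {T r : ℝ} {N : ℕ} {A : Set (Matrix (Fin d) (Fin d) ℝ)} {p : ℝ}
  {g : (Fin d → ℝ) → ℝ}

lemma bellW_good (hT : 0 < T) (hp : 0 ≤ p) (hA : IsCompact A) (hne : A.Nonempty)
    (hg : Good p g) (m : ℕ) : Good p (bellW d T r N A g m) := by
  induction m with
  | zero => exact hg
  | succ m ih => exact bell_good hT hp hA hne ih

lemma polPay_le (hT : 0 < T) (hp : 0 ≤ p) (hA : IsCompact A) (hne : A.Nonempty)
    (hg : Good p g) {π} (hπ : IsPolicy A π) (m : ℕ) :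
    ∀ x ∈ posO d, 0 ≤ polPay d T r N g π m x ∧
      polPay d T r N g π m x ≤ bellW d T r N A g m x := by
  induction m with
  | zero => exact fun x hx => ⟨hg.2.1 x hx, le_rfl⟩
  | succ m ih =>
    intro x hx
    have hW := bellW_good (r := r) (N := N) hT hp hA hne hg m
    have := (hπ (N - (m + 1))).1
    have hin : ∀ a, 0 ≤ ∫ z, polPay d T r N g π m (logEuler d T r N x a z) ∂(stdGaussian d) :=
      fun a => integral_nonneg fun z => (ih _ (logEuler_pos hx a z)).1
    refine ⟨integral_nonneg hin, ?_⟩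
    have hae : ∀ᵐ a ∂(π (N - (m + 1)) x), a ∈ A :=
      (prob_compl_eq_zero_iff hA.measurableSet).2 ((hπ _).2 x)
    have : ∫ a, ∫ z, polPay d T r N g π m (logEuler d T r N x a z)
        ∂(stdGaussian d) ∂((π (N - (m + 1))) x)
        ≤ ∫ a, bellW d T r N A g (m + 1) x ∂((π (N - (m + 1))) x) := by
      refine integral_mono_of_nonneg (ae_of_all _ hin) (integrable_const _) ?_
      filter_upwards [hae] with a ha
      refine le_trans ?_ ((bell_greatest (r := r) (N := N) hT hp hA hne hW hx).2 ⟨a, ha, rfl⟩)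
      exact integral_mono_of_nonneg (ae_of_all _ fun z => (ih _ (logEuler_pos hx a z)).1)
        (step_int hT hp hA hW hx ha) (ae_of_all _ fun z => (ih _ (logEuler_pos hx a z)).2)
    simpa [polPay] using this

lemma polPay_congr {π π' : ℕ → Kernel (Fin d → ℝ) (Matrix (Fin d) (Fin d) ℝ)} (m : ℕ)
    (h : ∀ k, N - m ≤ k → π k = π' k) :
    polPay d T r N g π m = polPay d T r N g π' m := by
  induction m with
  | zero => rfl
  | succ m ih =>
    have e := ih fun k hk => h k (by omega)
    simp only [polPay, e, h (N - (m + 1)) le_rfl]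

lemma exists_policy (hT : 0 < T) (hp : 0 ≤ p) (hA : IsCompact A) (hne : A.Nonempty)
    (hg : Good p g) (m : ℕ) (hm : m ≤ N) : ∀ ε : ℝ, 0 < ε →
    ∃ π, IsPolicy A π ∧ Measurable ((posO d).indicator (polPay d T r N g π m)) ∧
      ∀ x ∈ posO d, bellW d T r N A g m x - ε ≤ polPay d T r N g π m x := by
  classical
  induction m with
  | zero =>
    intro ε hε
    obtain ⟨a, ha⟩ := hne
    refine ⟨fun _ => Kernel.const _ (Measure.dirac a), fun k => ⟨inferInstance, fun x => ?_⟩,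
      ?_, fun x hx => by simp only [bellW, polPay]; linarith⟩
    · simp [Measure.dirac_apply' _ hA.measurableSet, ha]
    · rw [← Set.piecewise_eq_indicator]
      exact hg.1.measurable_piecewise continuousOn_const (isOpen_posO d).measurableSet
  | succ m ih =>
    intro ε hε
    obtain ⟨π, hπ, hmeas, hge⟩ := ih (by omega) (ε / 2) (half_pos hε)
    have hW := bellW_good (r := r) (N := N) hT hp hA hne hg m
    obtain ⟨s, hs, hsA, hsε⟩ := exists_selector (r := r) (N := N) hT hp hA hne hW (half_pos hε)
    let π' := Function.update π (N - (m + 1)) (Kernel.deterministic s hs)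
    have hπ' : IsPolicy A π' := by
      intro k
      by_cases hk : k = N - (m + 1)
      · subst hk
        simp only [π', Function.update_self]
        refine ⟨inferInstance, fun x => ?_⟩
        rw [Kernel.deterministic_apply' _ _ hA.measurableSet]
        simp [hsA x]
      · simp only [π', Function.update_of_ne hk]; exact hπ k
    have hcongr : polPay d T r N g π' m = polPay d T r N g π m := by
      refine polPay_congr m fun k hk => ?_
      exact Function.update_of_ne (by omega) _ _
    have hstep : ∀ x, polPay d T r N g π' (m + 1) x
        = ∫ z, polPay d T r N g π m (logEuler d T r N x (s x) z) ∂(stdGaussian d) := by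
      intro x
      simp only [polPay, hcongr]
      simp only [π', Function.update_self, Kernel.deterministic_apply]
      rw [integral_dirac]
    have hind : ∀ x ∈ posO d, ∀ a z, polPay d T r N g π m (logEuler d T r N x a z) =
        (posO d).indicator (polPay d T r N g π m) (logEuler d T r N x a z) := by
      intro x hx a z
      rw [Set.indicator_of_mem (logEuler_pos hx a z)]
    have hjm : Measurable fun q : (Fin d → ℝ) × (Fin d → ℝ) =>
        (posO d).indicator (polPay d T r N g π m) (logEuler d T r N q.1 (s q.1) q.2) :=
      hmeas.comp ((logEuler_cont d T r N).measurable.comp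
        (measurable_fst.prodMk ((hs.comp measurable_fst).prodMk measurable_snd)))
    refine ⟨π', hπ', ?_, fun x hx => ?_⟩
    · have h1 := (hjm.stronglyMeasurable.integral_prod_right' (ν := stdGaussian d)).measurable
      have h2 := h1.indicator (isOpen_posO d).measurableSet
      convert h2 using 1
      refine Set.indicator_congr fun x hx => ?_
      rw [hstep]
      exact integral_congr_ae (ae_of_all _ fun z => hind x hx _ z)
    · rw [hstep]
      have hWi := step_int (r := r) (N := N) hT hp hA hW hx (hsA x)
      have hpi : Integrable (fun z => polPay d T r N g π m (logEuler d T r N x (s x) z))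
          (stdGaussian d) := by
        refine hWi.mono' ?_ (ae_of_all _ fun z => ?_)
        · have : Measurable fun z => polPay d T r N g π m (logEuler d T r N x (s x) z) := by
            simp only [hind x hx]
            exact hjm.comp measurable_prodMk_left
          exact this.aestronglyMeasurable
        · have := polPay_le (r := r) (N := N) hT hp hA hne hg hπ m _
            (logEuler_pos (T := T) (r := r) (N := N) hx (s x) z)
          rw [Real.norm_eq_abs, abs_of_nonneg this.1]
          exact this.2
      have h1 : ∫ z, (bellW d T r N A g m (logEuler d T r N x (s x) z) - ε / 2) ∂(stdGaussian d)
          ≤ ∫ z, polPay d T r N g π m (logEuler d T r N x (s x) z) ∂(stdGaussian d) :=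
        integral_mono (hWi.sub (integrable_const _)) hpi
          fun z => hge _ (logEuler_pos hx (s x) z)
      rw [integral_sub hWi (integrable_const _)] at h1
      have h2 := hsε x hx
      simp only [integral_const, probReal_univ, one_smul, smul_eq_mul, one_mul] at h1
      simp only [stepE] at h2
      simp only [bellW]
      linarith

lemma valueFn_eq (hT : 0 < T) (hp : 0 ≤ p) (hA : IsCompact A) (hne : A.Nonempty)
    (hg : Good p g) (n : ℕ) {x} (hx : x ∈ posO d) :
    valueFn d T r N g A n x
      = Real.exp (-(r * (T - (n : ℝ) * T / N))) * bellW d T r N A g (N - n) x := by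
  unfold valueFn
  set c := Real.exp (-(r * (T - (n : ℝ) * T / N))) with hc
  have hc0 : 0 < c := Real.exp_pos _
  obtain ⟨π0, hπ0, _⟩ := exists_policy (r := r) (N := N) hT hp hA hne hg (N - n)
    (Nat.sub_le _ _) 1 one_pos
  refine csSup_eq_of_forall_le_of_forall_lt_exists_gt ⟨_, π0, hπ0, rfl⟩ ?_ ?_
  · rintro v ⟨π, hπ, rfl⟩
    exact mul_le_mul_of_nonneg_left (polPay_le hT hp hA hne hg hπ _ x hx).2 hc0.le
  · intro w hw
    have hw' : w / c < bellW d T r N A g (N - n) x := by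
      rw [div_lt_iff₀ hc0, mul_comm]; exact hw
    obtain ⟨π, hπ, _, hge⟩ := exists_policy (r := r) (N := N) hT hp hA hne hg (N - n)
      (Nat.sub_le _ _) ((bellW d T r N A g (N - n) x - w / c) / 2) (by linarith)
    refine ⟨_, ⟨π, hπ, rfl⟩, ?_⟩
    have := hge x hx
    have h2 : w / c < polPay d T r N g π (N - n) x := by linarith
    rw [div_lt_iff₀ hc0, mul_comm] at h2
    exact h2

end main

/-- Discrete dynamic programming principle, recursion: for a nonempty
compact action set `A` and a continuous, nonnegative payoff `g` of polynomial growth,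
`V_n(x) = max_{a ∈ A} ∫ e^{-rT/N} V_{n+1}(F(x,a,z)) dγ_d(z)`, the maximum over the
compact set `A` being attained. -/
theorem discrete_dpp_recursion
    (d : ℕ) (hd : 1 ≤ d) (T : ℝ) (hT : 0 < T) (r : ℝ) (hr : 0 ≤ r) (N : ℕ) (hN : 1 ≤ N)
    (A : Set (Matrix (Fin d) (Fin d) ℝ)) (hAne : A.Nonempty) (hAcomp : IsCompact A)
    (g : (Fin d → ℝ) → ℝ)
    (hgc : ContinuousOn g {x | ∀ i, 0 < x i})
    (hgnn : ∀ y : Fin d → ℝ, (∀ i, 0 < y i) → 0 ≤ g y)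
    (C p : ℝ) (hC : 0 ≤ C) (hp : 0 ≤ p)
    (hgrowth : ∀ y : Fin d → ℝ, (∀ i, 0 < y i) → |g y| ≤ C * (1 + ‖y‖ ^ p))
    (n : ℕ) (hn : n < N) (x : Fin d → ℝ) (hx : ∀ i, 0 < x i) :
    IsGreatest
      ((fun a : Matrix (Fin d) (Fin d) ℝ =>
          ∫ z, Real.exp (-(r * T / N)) *
            valueFn d T r N g A (n + 1) (logEuler d T r N x a z) ∂(stdGaussian d)) '' A)
      (valueFn d T r N g A n x) := by
  have hg : Good p g :=
    ⟨hgc, hgnn, C, hC, fun y hy => (le_abs_self _).trans (hgrowth y hy)⟩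
  have hx' : x ∈ posO d := hx
  have hW := bellW_good (r := r) (N := N) hT hp hAcomp hAne hg (N - (n + 1))
  have hG := bell_greatest (r := r) (N := N) hT hp hAcomp hAne hW hx'
  set c := Real.exp (-(r * (T - (n : ℝ) * T / N))) with hc
  have hc0 : 0 < c := Real.exp_pos _
  have hNn : N - n = N - (n + 1) + 1 := by omega
  have hV : valueFn d T r N g A n x
      = c * bell d T r N A (bellW d T r N A g (N - (n + 1))) x := by
    rw [valueFn_eq hT hp hAcomp hAne hg n hx', hNn]; rfl
  have hint : ∀ a, ∫ z, Real.exp (-(r * T / N)) *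
      valueFn d T r N g A (n + 1) (logEuler d T r N x a z) ∂(stdGaussian d)
      = c * stepE d T r N (bellW d T r N A g (N - (n + 1))) x a := by
    intro a
    unfold stepE
    rw [← integral_const_mul]
    refine integral_congr_ae (ae_of_all _ fun z => ?_)
    simp only
    rw [valueFn_eq hT hp hAcomp hAne hg (n + 1) (logEuler_pos hx' a z), ← mul_assoc,
      ← Real.exp_add, hc]
    congr 2
    have : (N : ℝ) ≠ 0 := by positivity
    push_cast
    field_simp
    ring
  simp only [hint, hV]
  obtain ⟨a, ha, e⟩ := hG.1
  refine ⟨⟨a, ha, by simp only [e]⟩, ?_⟩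
  rintro _ ⟨b, hb, rfl⟩
  exact mul_le_mul_of_nonneg_left (hG.2 ⟨b, hb, rfl⟩) hc0.le
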